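/- Let g ≥ 1, let B ⊆ ℝ^g be an open convex set, and let p : ℝ^g → M_g(ℝ) be a map whose entries p_{ij} are C^∞ on B. Assume that p(x) is a symmetric matrix for every x ∈ B, and that for all indices i, j, k and all x ∈ B the partial derivatives satisfy ∂p_{ij}/∂x_k (x) = ∂p_{kj}/∂x_i (x) (so that the 3-tensor (∂p_{ij}/∂x_k) is fully symmetric in i, j, k). Then there exists a function f : ℝ^g → ℝ, C^∞ on B, such that p_{ij}(x) = ∂²f/∂x_i ∂x_j (x) for all x ∈ B and all i, j; that is, p is the Hessian of f on B. -/

import Mathlib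

open scoped ContDiff in
/-- A smooth closed `1`-form on an open convex subset of `ι → ℝ`, given by its coefficients `a i`,
has a smooth primitive. -/
theorem Convex.exists_contDiffOn_forall_fderiv_single_eq {ι : Type*} [Fintype ι] [DecidableEq ι]
    {B : Set (ι → ℝ)} (hB : Convex ℝ B) (hBo : IsOpen B) {a : ι → (ι → ℝ) → ℝ}
    (ha : ∀ i, ContDiffOn ℝ ∞ (a i) B)
    (hclosed : ∀ i k, ∀ x ∈ B,
      fderiv ℝ (a i) x (Pi.single k 1) = fderiv ℝ (a k) x (Pi.single i 1)) :
    ∃ f : (ι → ℝ) → ℝ, ContDiffOn ℝ ∞ f B ∧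
      ∀ x ∈ B, ∀ i, fderiv ℝ f x (Pi.single i 1) = a i x := by
  set η : (ι → ℝ) → (ι → ℝ) →L[ℝ] ℝ :=
    fun x => ∑ i, a i x • ContinuousLinearMap.proj (R := ℝ) (φ := fun _ : ι => ℝ) i with hη
  have hηs : ContDiffOn ℝ ∞ η B := ContDiffOn.sum fun i _ => (ha i).smul contDiffOn_const
  have hη_single (x : ι → ℝ) (i : ι) : η x (Pi.single i 1) = a i x := by
    simp [hη, Pi.single_apply]
  have hη' (x : ι → ℝ) (hx : x ∈ B) (k i : ι) :
      fderiv ℝ η x (Pi.single k 1) (Pi.single i 1) = fderiv ℝ (a i) x (Pi.single k 1) := by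
    have hd : DifferentiableAt ℝ η x :=
      (hηs.differentiableOn (by simp)).differentiableAt (hBo.mem_nhds hx)
    have hcomp := hd.hasFDerivAt.clm_apply (hasFDerivAt_const (Pi.single i (1 : ℝ)) x)
    simp only [hη_single] at hcomp
    simp [hcomp.fderiv]
  have hsymm (x : ι → ℝ) (hx : x ∈ B) (v w : ι → ℝ) :
      fderiv ℝ η x v w = fderiv ℝ η x w v := by
    set L := (ContinuousLinearMap.coeLM ℝ).comp (fderiv ℝ η x).toLinearMap with hL
    suffices h : L = L.flip from LinearMap.congr_fun₂ h v w
    refine (Pi.basisFun ℝ ι).ext fun k => (Pi.basisFun ℝ ι).ext fun i => ?_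
    simp [hL, hη' x hx, hclosed i k x hx]
  obtain ⟨f, hf⟩ := hB.exists_forall_hasFDerivAt_of_fderiv_symmetric hBo
    (hηs.differentiableOn (by simp)) hsymm
  refine ⟨f, (contDiffOn_infty_iff_fderiv_of_isOpen hBo).2
    ⟨fun x hx => (hf x hx).differentiableAt.differentiableWithinAt,
      hηs.congr fun x hx => (hf x hx).fderiv⟩, fun x hx i => ?_⟩
  rw [(hf x hx).fderiv, hη_single]


/-- Strong cubic condition, real `C^∞` form: a symmetric-matrix-valued map `p` whose
derivative 3-tensor is fully symmetric is, on an open convex set, the Hessian of a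
function. -/
theorem stmt14 (g : ℕ) (hg : 0 < g) (B : Set (Fin g → ℝ))
    (hBopen : IsOpen B) (hBconv : Convex ℝ B)
    (p : (Fin g → ℝ) → Matrix (Fin g) (Fin g) ℝ)
    (hsmooth : ∀ i j, ContDiffOn ℝ (⊤ : ℕ∞) (fun z => p z i j) B)
    (hsymm : ∀ x ∈ B, ∀ i j, p x i j = p x j i)
    (hderiv : ∀ i j k, ∀ x ∈ B,
      fderiv ℝ (fun z => p z i j) x (Pi.single k 1) =
        fderiv ℝ (fun z => p z k j) x (Pi.single i 1)) :
    ∃ f : (Fin g → ℝ) → ℝ, ContDiffOn ℝ (⊤ : ℕ∞) f B ∧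
      ∀ x ∈ B, ∀ i j, p x i j =
        fderiv ℝ (fun z => fderiv ℝ f z (Pi.single j 1)) x (Pi.single i 1) := by
  choose u hu hup using fun j => hBconv.exists_contDiffOn_forall_fderiv_single_eq hBopen
    (a := fun i z => p z i j) (fun i => hsmooth i j) (fun i k x hx => hderiv i j k x hx)
  obtain ⟨f, hf, hfu⟩ := hBconv.exists_contDiffOn_forall_fderiv_single_eq hBopen (a := u) hu
    fun i k x hx => by rw [hup i x hx k, hup k x hx i, hsymm x hx k i]
  refine ⟨f, hf, fun x hx i j => ?_⟩
  have heq : (fun z => fderiv ℝ f z (Pi.single j 1)) =ᶠ[nhds x] u j := by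
    filter_upwards [hBopen.mem_nhds hx] with z hz using hfu z hz j
  rw [heq.fderiv_eq, hup j x hx i]
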